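/- Let k be an integer exceeding three. A loopless graph G is in F_k if and only if G is in F_{k-1} and G does not have a cc-minor isomorphic to the bond graph B_{k-1}. -/

import Mathlib

open scoped Classical

noncomputable section

/-- A finite multigraph with vertices and edge names drawn from `ℕ`.
Each edge name `e ∈ E` has a pair of (possibly equal) endpoints `ends e`. -/
structure MGraph where
  V : Finset ℕ
  E : Finset ℕ
  ends : ℕ → Sym2 ℕ
  ends_mem : ∀ e ∈ E, ∀ v ∈ ends e, v ∈ V

namespace MGraph

/-- Adjacency via some edge. -/
def Adj (G : MGraph) (u v : ℕ) : Prop := ∃ e ∈ G.E, G.ends e = s(u, v)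

/-- Reachability. -/
def Reach (G : MGraph) : ℕ → ℕ → Prop := Relation.ReflTransGen G.Adj

/-- A graph is connected if it has a vertex and all vertices are mutually reachable. -/
def Connected (G : MGraph) : Prop :=
  G.V.Nonempty ∧ ∀ u ∈ G.V, ∀ v ∈ G.V, G.Reach u v

/-- Delete a set of edges. -/
def deleteEdges (G : MGraph) (Z : Finset ℕ) : MGraph where
  V := G.V
  E := G.E \ Z
  ends := G.ends
  ends_mem := fun e he => G.ends_mem e (Finset.mem_sdiff.mp he).1

/-- A graph with at least two vertices is `k`-edge-connected if deleting any
set of fewer than `k` edges leaves it connected. -/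
def EdgeConnected (G : MGraph) (k : ℕ) : Prop :=
  2 ≤ G.V.card ∧ ∀ Z ⊆ G.E, Z.card < k → (G.deleteEdges Z).Connected

/-- A graph is loopless if no edge has equal endpoints. -/
def Loopless (G : MGraph) : Prop := ∀ e ∈ G.E, ¬ (G.ends e).IsDiag

/-- The set of vertices met by an edge set. -/
def vertsOf (G : MGraph) (C : Finset ℕ) : Finset ℕ :=
  G.V.filter (fun v => ∃ e ∈ C, v ∈ G.ends e)

/-- Degree of `v` in the edge set `C` (loops counted twice). -/
def degIn (G : MGraph) (C : Finset ℕ) (v : ℕ) : ℕ :=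
  ∑ e ∈ C, (if G.ends e = s(v, v) then 2 else if v ∈ G.ends e then 1 else 0)

/-- `C` is the edge set of a cycle of `G`: a nonempty connected edge set in which
every vertex met has degree exactly two (a loop and a pair of parallel edges are cycles). -/
def IsCycleSet (G : MGraph) (C : Finset ℕ) : Prop :=
  C.Nonempty ∧ C ⊆ G.E ∧
  (∀ v ∈ G.vertsOf C, G.degIn C v = 2) ∧
  ∀ u ∈ G.vertsOf C, ∀ v ∈ G.vertsOf C,
    Relation.ReflTransGen (fun a b => ∃ e ∈ C, G.ends e = s(a, b)) u v

/-- The vertex map identifying all vertices of `U` (within `G.V`) to a single one. -/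
def cmapOn (G : MGraph) (U : Finset ℕ) : ℕ → ℕ :=
  fun v => if v ∈ U ∩ G.V then sInf {w : ℕ | w ∈ U ∩ G.V} else v

/-- Contract the vertex set `U` to a single vertex, deleting the edges of `S` and all
newly created loops (edges with both ends in `U` that were not already loops), while
keeping pre-existing loops not in `S`. -/
def contractOn (G : MGraph) (U S : Finset ℕ) : MGraph where
  V := G.V.image (G.cmapOn U)
  E := G.E.filter (fun e => ¬ (∀ v ∈ G.ends e, v ∈ U) ∨ ((G.ends e).IsDiag ∧ e ∉ S))
  ends := fun e => (G.ends e).map (G.cmapOn U)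
  ends_mem := by
    intro e he v hv
    have he' : e ∈ G.E := (Finset.mem_filter.mp he).1
    rw [Sym2.mem_map] at hv
    obtain ⟨w, hw, rfl⟩ := hv
    have hwV : w ∈ G.V := G.ends_mem e he' w hw
    by_cases h : w ∈ U ∩ G.V
    · have hmem : sInf {x : ℕ | x ∈ U ∩ G.V} ∈ U ∩ G.V := Nat.sInf_mem ⟨w, h⟩
      refine Finset.mem_image.mpr ⟨sInf {x : ℕ | x ∈ U ∩ G.V},
        (Finset.mem_inter.mp hmem).2, ?_⟩
      simp [cmapOn, h, hmem]
    · exact Finset.mem_image.mpr ⟨w, hwV, by simp [cmapOn, h]⟩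

/-- Contract a cycle (given by its edge set), deleting all created loops. -/
def contractCycle (G : MGraph) (C : Finset ℕ) : MGraph :=
  G.contractOn (G.vertsOf C) C

/-- `H` is a cycle-contraction minor (cc-minor) of `G`: `H` is obtained from `G` by
a sequence of cycle contractions (each accompanied by contraction of created loops). -/
def CCMinor (G H : MGraph) : Prop :=
  Relation.ReflTransGen (fun A B => ∃ C, A.IsCycleSet C ∧ B = A.contractCycle C) G H

/-- Walks: a vertex list together with a matching edge list. -/
inductive IsWalk (G : MGraph) : List ℕ → List ℕ → Prop
  | nil {v : ℕ} (hv : v ∈ G.V) : IsWalk G [v] []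
  | cons {u v : ℕ} {e : ℕ} {vs es : List ℕ} (he : e ∈ G.E)
      (hends : G.ends e = s(u, v)) (hw : IsWalk G (v :: vs) es) :
      IsWalk G (u :: v :: vs) (e :: es)

/-- A path from `u` to `v`, given by its vertex list and edge list. -/
def IsPathBetween (G : MGraph) (u v : ℕ) (vs es : List ℕ) : Prop :=
  G.IsWalk vs es ∧ vs.Nodup ∧ vs.head? = some u ∧ vs.getLast? = some v

/-- `G` is `k`-connected: it has at least `k` vertices and any two distinct vertices are
joined by at least `k` pairwise internally disjoint paths. -/
def KConnected (G : MGraph) (k : ℕ) : Prop :=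
  k ≤ G.V.card ∧ ∀ u ∈ G.V, ∀ v ∈ G.V, u ≠ v →
    ∃ P : Fin k → List ℕ × List ℕ,
      (∀ i, G.IsPathBetween u v (P i).1 (P i).2) ∧
      ∀ i j, i ≠ j →
        (∀ x, x ∈ (P i).1 → x ∈ (P j).1 → x = u ∨ x = v) ∧
        (∀ e, e ∈ (P i).2 → e ∉ (P j).2)

/-- A simple graph: no loops and no parallel edges. -/
def Simple (G : MGraph) : Prop :=
  G.Loopless ∧ ∀ e ∈ G.E, ∀ f ∈ G.E, G.ends e = G.ends f → e = f

/-- Graph isomorphism. -/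
def Iso (G H : MGraph) : Prop :=
  ∃ φ ψ : ℕ → ℕ, Set.BijOn φ ↑G.V ↑H.V ∧ Set.BijOn ψ ↑G.E ↑H.E ∧
    ∀ e ∈ G.E, H.ends (ψ e) = (G.ends e).map φ

/-- The bond graph `B n`: two vertices joined by `n` parallel edges. -/
def IsBondGraph (H : MGraph) (n : ℕ) : Prop :=
  ∃ u v : ℕ, u ≠ v ∧ H.V = {u, v} ∧ H.E.card = n ∧ ∀ e ∈ H.E, H.ends e = s(u, v)

end MGraph

namespace MGraph

/-- `F` is a subgraph of `G`. -/
def IsSubgraph (F G : MGraph) : Prop :=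
  F.V ⊆ G.V ∧ F.E ⊆ G.E ∧ ∀ e ∈ F.E, F.ends e = G.ends e

end MGraph

/-- The class `F_k`: for `k = 1`, loopless connected graphs; for `k > 1`, loopless
`k`-edge-connected graphs together with the single-vertex graph `K₁`. -/
def Fclass (k : ℕ) (G : MGraph) : Prop :=
  if k = 1 then G.Loopless ∧ G.Connected
  else (G.Loopless ∧ G.EdgeConnected k) ∨ (G.V.card = 1 ∧ G.E = ∅)

namespace MGraph

/-! ### Edge cuts -/

/-- The edges having an end inside `p` and an end outside `p`. -/
def cutEdges (G : MGraph) (p : ℕ → Prop) : Finset ℕ :=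
  G.E.filter (fun e => (∃ a ∈ G.ends e, p a) ∧ ∃ b ∈ G.ends e, ¬ p b)

/-- Every edge cut separating two vertices of `G` has at least `k` edges. -/
def CutsAtLeast (G : MGraph) (k : ℕ) : Prop :=
  ∀ p : ℕ → Prop, (∃ v ∈ G.V, p v) → (∃ v ∈ G.V, ¬ p v) → k ≤ (G.cutEdges p).card

theorem cutEdges_not (G : MGraph) (p : ℕ → Prop) :
    G.cutEdges (fun v => ¬ p v) = G.cutEdges p := by
  unfold cutEdges
  refine Finset.filter_congr fun e _ => ?_
  simp only [not_not]
  exact and_comm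

theorem cutEdges_congr (G : MGraph) {p q : ℕ → Prop} (h : ∀ v ∈ G.V, (p v ↔ q v)) :
    G.cutEdges p = G.cutEdges q := by
  unfold cutEdges
  refine Finset.filter_congr fun e he => ?_
  refine and_congr (exists_congr fun a => and_congr_right fun ha => h a (G.ends_mem e he a ha))
    (exists_congr fun a => and_congr_right fun ha => not_congr (h a (G.ends_mem e he a ha)))

theorem edgeConnected_iff (G : MGraph) (k : ℕ) :
    G.EdgeConnected k ↔ 2 ≤ G.V.card ∧ G.CutsAtLeast k := by
  refine and_congr_right fun hV => ⟨fun h p ⟨u, hu, pu⟩ ⟨v, hv, pv⟩ => ?_, fun h Z _ hZ => ?_⟩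
  · by_contra! hlt
    have hr := (h (G.cutEdges p) (Finset.filter_subset _ _) hlt).2 u hu v hv
    refine pv ?_
    clear hv pv
    induction hr with
    | refl => exact pu
    | tail _ hbc ih =>
      obtain ⟨e, he, hbc⟩ := hbc
      by_contra hc
      have he' := Finset.mem_sdiff.mp he
      change G.ends e = _ at hbc
      refine he'.2 (Finset.mem_filter.mpr ⟨he'.1, ⟨_, ?_, ih⟩, _, ?_, hc⟩) <;> simp [hbc]
  · refine ⟨Finset.card_pos.mp (by change 0 < G.V.card; omega), fun u hu v hv => ?_⟩
    by_contra hr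
    refine absurd (h ((G.deleteEdges Z).Reach u) ⟨u, hu, .refl⟩ ⟨v, hv, hr⟩) (not_le.mpr ?_)
    refine (Finset.card_le_card fun e he => ?_).trans_lt hZ
    obtain ⟨he, ⟨a, ha, ra⟩, b, hb, rb⟩ := Finset.mem_filter.mp he
    by_contra hZe
    have hne : a ≠ b := by rintro rfl; exact rb ra
    exact rb (ra.tail ⟨e, Finset.mem_sdiff.mpr ⟨he, hZe⟩, (Sym2.mem_and_mem_iff hne).mp ⟨ha, hb⟩⟩)

/-! ### Existence of cycles -/

theorem mem_vertsOf {G : MGraph} {C : Finset ℕ} (hC : C ⊆ G.E) {v : ℕ} :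
    v ∈ G.vertsOf C ↔ ∃ e ∈ C, v ∈ G.ends e := by
  simp only [vertsOf, Finset.mem_filter, and_iff_right_iff_imp]
  rintro ⟨e, he, hv⟩
  exact G.ends_mem e (hC he) v hv

theorem sum_degIn_le (G : MGraph) (C S : Finset ℕ) : ∑ v ∈ S, G.degIn C v ≤ 2 * C.card := by
  unfold degIn
  rw [Finset.sum_comm, mul_comm, ← smul_eq_mul]
  refine Finset.sum_le_card_nsmul _ _ _ fun e _ => ?_
  induction h : G.ends e with
  | h a b =>
    calc _ ≤ ∑ v ∈ S, ((if v = a then 1 else 0) + (if v = b then 1 else 0)) := by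
          refine Finset.sum_le_sum fun v _ => ?_
          simp only [Sym2.eq_iff, Sym2.mem_iff]
          split_ifs <;> grind
      _ ≤ 2 := by
          rw [Finset.sum_add_distrib, Finset.sum_ite_eq', Finset.sum_ite_eq']
          split_ifs <;> omega

/-- A vertex of degree less than two in `C` is met by only one edge of `C`, which is no loop. -/
theorem exists_pendant_of_degIn_lt_two {G : MGraph} {C : Finset ℕ} (hC : C ⊆ G.E) {v : ℕ}
    (hv : v ∈ G.vertsOf C) (h : G.degIn C v < 2) :
    ∃ e ∈ C, v ∈ G.ends e ∧ G.ends e ≠ s(v, v) ∧ ∀ f ∈ C.erase e, v ∉ G.ends f := by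
  obtain ⟨e, he, hve⟩ := (mem_vertsOf hC).mp hv
  unfold degIn at h
  rw [← Finset.add_sum_erase _ _ he] at h
  have hne : G.ends e ≠ s(v, v) := by
    intro h'
    rw [if_pos h'] at h
    omega
  rw [if_neg hne, if_pos hve] at h
  refine ⟨e, he, hve, hne, fun f hf hvf => ?_⟩
  have := Finset.single_le_sum (f := fun e => if G.ends e = s(v, v) then 2
    else if v ∈ G.ends e then 1 else 0) (fun _ _ => Nat.zero_le _) hf
  simp only [if_pos hvf] at this
  split_ifs at this <;> omega

/-- A nonempty edge set with at least as many edges as vertices contains a cycle. -/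
theorem exists_isCycleSet_subset {G : MGraph} {F : Finset ℕ} (hF : F ⊆ G.E) (hne : F.Nonempty)
    (hcard : (G.vertsOf F).card ≤ F.card) : ∃ C ⊆ F, G.IsCycleSet C := by
  induction hn : F.card using Nat.strong_induction_on generalizing F with
  | _ n ih =>
  subst hn
  by_cases hsmall : ∃ D ⊂ F, D.Nonempty ∧ (G.vertsOf D).card ≤ D.card
  · obtain ⟨D, hD, hDne, hDc⟩ := hsmall
    obtain ⟨C, hC, hcyc⟩ := ih _ (Finset.card_lt_card hD) (hD.1.trans hF) hDne hDc rfl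
    exact ⟨C, hC.trans hD.1, hcyc⟩
  push Not at hsmall
  have hmono : ∀ D ⊆ F, G.vertsOf D ⊆ G.vertsOf F := fun D hD v hv => by
    obtain ⟨e, he, hve⟩ := (mem_vertsOf (hD.trans hF)).mp hv
    exact (mem_vertsOf hF).mpr ⟨e, hD he, hve⟩
  have hpos : 0 < (G.vertsOf F).card := by
    obtain ⟨e, he⟩ := hne
    induction h : G.ends e with
    | h a b => exact Finset.card_pos.mpr ⟨a, (mem_vertsOf hF).mpr ⟨e, he, by simp [h]⟩⟩
  have heq : F.card = (G.vertsOf F).card := by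
    by_contra hne'
    obtain ⟨e, he⟩ := hne
    have hc := Finset.card_erase_of_mem he
    have h1 := hsmall _ (Finset.erase_ssubset he) (Finset.card_pos.mp (by omega))
    have h2 := Finset.card_le_card (hmono _ (Finset.erase_subset e F))
    omega
  have hdeg : ∀ v ∈ G.vertsOf F, 2 ≤ G.degIn F v := by
    intro v hv
    by_contra! hlt
    obtain ⟨e, he, hve, hloop, huniq⟩ := exists_pendant_of_degIn_lt_two hF hv hlt
    have htwo : 1 < (G.vertsOf F).card := by
      obtain ⟨w, hw⟩ := hve
      refine Finset.one_lt_card.mpr ⟨v, hv, w, (mem_vertsOf hF).mpr ⟨e, he, by simp [hw]⟩, ?_⟩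
      rintro rfl
      exact hloop hw
    have hc := Finset.card_erase_of_mem he
    have h1 := hsmall _ (Finset.erase_ssubset he) (Finset.card_pos.mp (by omega))
    have h2 : G.vertsOf (F.erase e) ⊆ (G.vertsOf F).erase v := fun w hw => by
      refine Finset.mem_erase.mpr ⟨?_, hmono _ (Finset.erase_subset e F) hw⟩
      rintro rfl
      obtain ⟨f, hf, hwf⟩ := (mem_vertsOf ((Finset.erase_subset e F).trans hF)).mp hw
      exact huniq f hf hwf
    have h3 := Finset.card_le_card h2
    rw [Finset.card_erase_of_mem hv] at h3
    omega
  refine ⟨F, subset_rfl, hne, hF, ?_, ?_⟩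
  · have hsum : ∑ v ∈ G.vertsOf F, 2 = ∑ v ∈ G.vertsOf F, G.degIn F v := by
      refine le_antisymm (Finset.sum_le_sum hdeg) ((G.sum_degIn_le F _).trans_eq ?_)
      rw [Finset.sum_const, smul_eq_mul, heq, mul_comm]
    intro v hv
    exact ((Finset.sum_eq_sum_iff_of_le hdeg).mp hsum v hv).symm
  · intro u hu v hv
    by_contra hr
    set R := Relation.ReflTransGen (fun a b => ∃ e ∈ F, G.ends e = s(a, b)) with hR
    set D := F.filter (fun e => ∀ w ∈ G.ends e, R u w) with hD
    have hside : ∀ e ∈ F, ∀ a ∈ G.ends e, R u a → e ∈ D := by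
      intro e he a ha hua
      refine Finset.mem_filter.mpr ⟨he, fun w hw => ?_⟩
      obtain ⟨b, hb⟩ := ha
      rw [hb, Sym2.mem_iff] at hw
      rcases hw with rfl | rfl
      · exact hua
      · exact hua.tail ⟨e, he, hb⟩
    have hDF : D ⊆ F := Finset.filter_subset _ _
    obtain ⟨e, he, hue⟩ := (mem_vertsOf hF).mp hu
    obtain ⟨f, hf, hvf⟩ := (mem_vertsOf hF).mp hv
    have heD : e ∈ D := hside e he u hue .refl
    have hfD : f ∉ D := fun h => hr ((Finset.mem_filter.mp h).2 v hvf)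
    have h1 := hsmall D ⟨hDF, fun h => hfD (h hf)⟩ ⟨e, heD⟩
    have h2 := hsmall (F \ D) ⟨Finset.sdiff_subset, fun h => (Finset.mem_sdiff.mp (h he)).2 heD⟩
      ⟨f, Finset.mem_sdiff.mpr ⟨hf, hfD⟩⟩
    have hdisj : Disjoint (G.vertsOf D) (G.vertsOf (F \ D)) := by
      refine Finset.disjoint_left.mpr fun w hw hw' => ?_
      obtain ⟨g, hg, hwg⟩ := (mem_vertsOf (hDF.trans hF)).mp hw
      obtain ⟨g', hg', hwg'⟩ := (mem_vertsOf (Finset.sdiff_subset.trans hF)).mp hw'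
      obtain ⟨hg'F, hg'D⟩ := Finset.mem_sdiff.mp hg'
      exact hg'D (hside g' hg'F w hwg' ((Finset.mem_filter.mp hg).2 w hwg))
    have h3 := Finset.card_le_card
      (Finset.union_subset (hmono D hDF) (hmono (F \ D) Finset.sdiff_subset))
    rw [Finset.card_union_of_disjoint hdisj] at h3
    have h4 := Finset.card_sdiff_add_card_eq_card hDF
    omega

/-! ### Contractions -/

theorem cmapOn_of_mem {G : MGraph} {U : Finset ℕ} {v : ℕ} (h : v ∈ U ∩ G.V) :
    G.cmapOn U v = sInf {w : ℕ | w ∈ U ∩ G.V} := if_pos h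

theorem cmapOn_mem {G : MGraph} {U : Finset ℕ} {v : ℕ} (h : v ∈ U ∩ G.V) :
    G.cmapOn U v ∈ U ∩ G.V := by
  rw [cmapOn_of_mem h]
  exact Nat.sInf_mem ⟨v, h⟩

theorem cmapOn_of_notMem {G : MGraph} {U : Finset ℕ} {v : ℕ} (h : v ∉ U ∩ G.V) :
    G.cmapOn U v = v := if_neg h

theorem cutEdges_contractOn (G : MGraph) (U S : Finset ℕ) (p : ℕ → Prop) :
    (G.contractOn U S).cutEdges p = G.cutEdges (fun v => p (G.cmapOn U v)) := by
  ext e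
  simp only [cutEdges, contractOn, Finset.mem_filter, Sym2.mem_map]
  constructor
  · rintro ⟨⟨he, -⟩, ⟨_, ⟨a, ha, rfl⟩, pa⟩, _, ⟨b, hb, rfl⟩, pb⟩
    exact ⟨he, ⟨a, ha, pa⟩, b, hb, pb⟩
  · rintro ⟨he, ⟨a, ha, pa⟩, b, hb, pb⟩
    refine ⟨⟨he, .inl fun h => pb ?_⟩, ⟨_, ⟨a, ha, rfl⟩, pa⟩, _, ⟨b, hb, rfl⟩, pb⟩
    rwa [cmapOn_of_mem (Finset.mem_inter.mpr ⟨h b hb, G.ends_mem e he b hb⟩),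
      ← cmapOn_of_mem (Finset.mem_inter.mpr ⟨h a ha, G.ends_mem e he a ha⟩)]

theorem CutsAtLeast.contractOn {G : MGraph} {k : ℕ} (h : G.CutsAtLeast k) (U S : Finset ℕ) :
    (G.contractOn U S).CutsAtLeast k := by
  rintro p ⟨u, hu, pu⟩ ⟨v, hv, pv⟩
  obtain ⟨a, ha, rfl⟩ := Finset.mem_image.mp hu
  obtain ⟨b, hb, rfl⟩ := Finset.mem_image.mp hv
  rw [cutEdges_contractOn]
  exact h _ ⟨a, ha, pu⟩ ⟨b, hb, pv⟩

theorem CutsAtLeast.ccMinor {G H : MGraph} {k : ℕ} (h : G.CutsAtLeast k) (hH : G.CCMinor H) :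
    H.CutsAtLeast k := by
  induction hH with
  | refl => exact h
  | tail _ hstep ih =>
    obtain ⟨C, -, rfl⟩ := hstep
    exact ih.contractOn _ _

theorem CCMinor.card_le {G H : MGraph} (hH : G.CCMinor H) : H.V.card ≤ G.V.card := by
  induction hH with
  | refl => exact le_rfl
  | tail _ hstep ih =>
    obtain ⟨C, -, rfl⟩ := hstep
    exact Finset.card_image_le.trans ih

theorem Loopless.contractOn {G : MGraph} (h : G.Loopless) (U S : Finset ℕ) :
    (G.contractOn U S).Loopless := by
  intro e he hdiag
  obtain ⟨he, hU⟩ := Finset.mem_filter.mp he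
  have hU := hU.resolve_right fun h' => h e he h'.1
  change ((G.ends e).map (G.cmapOn U)).IsDiag at hdiag
  have hends := G.ends_mem e he
  have hloop := h e he
  induction h : G.ends e with
  | h a b =>
    rw [h] at hU hdiag hends hloop
    have ha := hends a (by simp)
    have hb := hends b (by simp)
    simp only [Sym2.map_mk, Sym2.mk_isDiag_iff, Sym2.mem_iff, forall_eq_or_imp, forall_eq,
      not_and] at hdiag hloop hU
    by_cases haU : a ∈ U ∩ G.V <;> by_cases hbU : b ∈ U ∩ G.V
    · exact hU (Finset.mem_inter.mp haU).1 (Finset.mem_inter.mp hbU).1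
    · have := cmapOn_mem haU
      rw [hdiag, cmapOn_of_notMem hbU] at this
      exact hbU this
    · have := cmapOn_mem hbU
      rw [← hdiag, cmapOn_of_notMem haU] at this
      exact haU this
    · rw [cmapOn_of_notMem haU, cmapOn_of_notMem hbU] at hdiag
      exact hloop hdiag

/-! ### Shrinking the sides of an edge cut -/

theorem sum_card_cutEdges_eq_le (G : MGraph) (p : ℕ → Prop) :
    ∑ v ∈ G.V.filter p, (G.cutEdges (· = v)).card ≤
      2 * (G.E.filter (fun e => ∀ v ∈ G.ends e, p v)).card + (G.cutEdges p).card := by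
  simp only [cutEdges, Finset.card_filter]
  rw [Finset.sum_comm, Finset.mul_sum, ← Finset.sum_add_distrib]
  refine Finset.sum_le_sum fun e _ => ?_
  induction h : G.ends e with
  | h a b =>
    calc _ ≤ ∑ v ∈ G.V.filter p, ((if v = a then 1 else 0) + (if v = b then 1 else 0)) := by
          refine Finset.sum_le_sum fun v _ => ?_
          simp only [Sym2.mem_iff]
          split_ifs <;> grind
      _ ≤ _ := by
          rw [Finset.sum_add_distrib, Finset.sum_ite_eq', Finset.sum_ite_eq']
          simp only [Finset.mem_filter, Sym2.mem_iff]
          split_ifs <;> grind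

/-- If all cuts have at least `m ≥ 3` edges, then a side with at least two vertices of a cut with
`m` edges induces a cycle. -/
theorem CutsAtLeast.exists_isCycleSet {G : MGraph} {m : ℕ} (hm : 3 ≤ m) (hcut : G.CutsAtLeast m)
    {p : ℕ → Prop} (hout : ∃ v ∈ G.V, ¬ p v) (hp : (G.cutEdges p).card = m)
    (htwo : 2 ≤ (G.V.filter p).card) :
    ∃ C, G.IsCycleSet C ∧ ∀ v ∈ G.vertsOf C, p v := by
  set F := G.E.filter (fun e => ∀ v ∈ G.ends e, p v) with hF
  have hFE : F ⊆ G.E := Finset.filter_subset _ _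
  have hverts : G.vertsOf F ⊆ G.V.filter p := fun v hv => by
    obtain ⟨e, he, hve⟩ := (mem_vertsOf hFE).mp hv
    exact Finset.mem_filter.mpr ⟨(Finset.mem_filter.mp hv).1, (Finset.mem_filter.mp he).2 v hve⟩
  have hlow : (G.V.filter p).card * m ≤ ∑ v ∈ G.V.filter p, (G.cutEdges (· = v)).card := by
    refine Finset.card_nsmul_le_sum _ _ _ fun v hv => ?_
    obtain ⟨w, hw, pw⟩ := hout
    obtain ⟨hvV, pv⟩ := Finset.mem_filter.mp hv
    exact hcut _ ⟨v, hvV, rfl⟩ ⟨w, hw, by rintro rfl; exact pw pv⟩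
  have hup := G.sum_card_cutEdges_eq_le p
  have hFcard : (G.V.filter p).card ≤ F.card := by
    rw [hp, ← hF] at hup
    obtain ⟨n, hn⟩ := Nat.exists_eq_add_of_le htwo
    rw [hn] at hlow ⊢
    nlinarith
  obtain ⟨C, hCF, hC⟩ := exists_isCycleSet_subset hFE (Finset.card_pos.mp (by omega))
    ((Finset.card_le_card hverts).trans hFcard)
  refine ⟨C, hC, fun v hv => ?_⟩
  obtain ⟨e, he, hve⟩ := (mem_vertsOf (hCF.trans hFE)).mp hv
  exact (Finset.mem_filter.mp (hCF he)).2 v hve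

theorem isBondGraph_of_card_eq_two {G : MGraph} (hG : G.Loopless) (hV : G.V.card = 2)
    {p : ℕ → Prop} (hin : ∃ v ∈ G.V, p v) (hout : ∃ v ∈ G.V, ¬ p v) :
    G.IsBondGraph (G.cutEdges p).card := by
  obtain ⟨u, hu, pu⟩ := hin
  obtain ⟨v, hv, pv⟩ := hout
  have huv : u ≠ v := by rintro rfl; exact pv pu
  have hVeq : G.V = {u, v} := by
    refine (Finset.eq_of_subset_of_card_le ?_ ?_).symm
    · simp [Finset.insert_subset_iff, hu, hv]
    · rw [hV, Finset.card_pair huv]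
  have hends : ∀ e ∈ G.E, G.ends e = s(u, v) := by
    intro e he
    have hmem := G.ends_mem e he
    have hloop := hG e he
    induction h : G.ends e with
    | h a b =>
      rw [h] at hmem hloop
      have ha := hmem a (by simp)
      have hb := hmem b (by simp)
      rw [Sym2.mk_isDiag_iff] at hloop
      simp only [hVeq, Finset.mem_insert, Finset.mem_singleton] at ha hb
      rw [Sym2.eq_iff]
      grind
  refine ⟨u, v, huv, hVeq, ?_, hends⟩
  congr 1
  refine (Finset.filter_true_of_mem fun e he => ?_).symm
  rw [hends e he]
  exact ⟨⟨u, by simp, pu⟩, v, by simp, pv⟩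

theorem Loopless.one_lt_card_vertsOf {G : MGraph} (hG : G.Loopless) {C : Finset ℕ}
    (hC : G.IsCycleSet C) : 1 < (G.vertsOf C).card := by
  obtain ⟨⟨e, he⟩, hCE, -⟩ := hC
  have hloop := hG e (hCE he)
  induction h : G.ends e with
  | h a b =>
    rw [h, Sym2.mk_isDiag_iff] at hloop
    exact Finset.one_lt_card.mpr ⟨a, (mem_vertsOf hCE).mpr ⟨e, he, by simp [h]⟩,
      b, (mem_vertsOf hCE).mpr ⟨e, he, by simp [h]⟩, hloop⟩

theorem card_contractOn_lt {G : MGraph} {U : Finset ℕ} (S : Finset ℕ) (hU : U ⊆ G.V)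
    (h : 1 < U.card) : (G.contractOn U S).V.card < G.V.card := by
  obtain ⟨a, ha, b, hb, hab⟩ := Finset.one_lt_card.mp h
  refine lt_of_le_of_ne Finset.card_image_le fun heq => hab ?_
  refine Finset.card_image_iff.mp heq (hU ha) (hU hb) ?_
  rw [cmapOn_of_mem (Finset.mem_inter.mpr ⟨ha, hU ha⟩),
    cmapOn_of_mem (Finset.mem_inter.mpr ⟨hb, hU hb⟩)]

/-- If all cuts of a loopless graph have at least `m ≥ 3` edges and some cut has exactly `m` edges,
then the bond graph with `m` edges is a cc-minor. -/
theorem exists_ccMinor_isBondGraph {m : ℕ} (hm : 3 ≤ m) {G : MGraph} (hG : G.Loopless)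
    (hcut : G.CutsAtLeast m) {p : ℕ → Prop} (hin : ∃ v ∈ G.V, p v) (hout : ∃ v ∈ G.V, ¬ p v)
    (hp : (G.cutEdges p).card = m) : ∃ H, G.CCMinor H ∧ H.IsBondGraph m := by
  induction hn : G.V.card using Nat.strong_induction_on generalizing G p with
  | _ n ih =>
  subst hn
  wlog htwo : 2 ≤ (G.V.filter p).card generalizing p
  · by_cases hother : 2 ≤ (G.V.filter (fun v => ¬ p v)).card
    · exact this hout (by simpa using hin) (by rwa [cutEdges_not]) (by convert hother)
    · have hcard := Finset.card_filter_add_card_filter_not (s := G.V) p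
      have hleft : 0 < (G.V.filter p).card := by
        obtain ⟨u, hu, pu⟩ := hin
        exact Finset.card_pos.mpr ⟨u, Finset.mem_filter.mpr ⟨hu, pu⟩⟩
      have hright : 0 < (G.V.filter (fun v => ¬ p v)).card := by
        obtain ⟨u, hu, pu⟩ := hout
        exact Finset.card_pos.mpr ⟨u, Finset.mem_filter.mpr ⟨hu, pu⟩⟩
      exact ⟨G, .refl, hp ▸ isBondGraph_of_card_eq_two hG (by omega) hin hout⟩
  obtain ⟨C, hC, hCp⟩ := hcut.exists_isCycleSet hm hout hp htwo
  have hUV : G.vertsOf C ⊆ G.V := Finset.filter_subset _ _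
  have hinv : ∀ v ∈ G.V, (p (G.cmapOn (G.vertsOf C) v) ↔ p v) := by
    intro v _
    by_cases hvU : v ∈ G.vertsOf C ∩ G.V
    · exact iff_of_true (hCp _ (Finset.mem_inter.mp (cmapOn_mem hvU)).1)
        (hCp _ (Finset.mem_inter.mp hvU).1)
    · rw [cmapOn_of_notMem hvU]
  obtain ⟨u, hu, pu⟩ := hin
  obtain ⟨w, hw, pw⟩ := hout
  obtain ⟨H, hH, hbond⟩ := ih (G.contractCycle C).V.card
    (card_contractOn_lt C hUV (hG.one_lt_card_vertsOf hC)) (hG.contractOn _ _)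
    (hcut.contractOn _ _) (p := p)
    ⟨_, Finset.mem_image_of_mem _ hu, (hinv u hu).mpr pu⟩
    ⟨_, Finset.mem_image_of_mem _ hw, fun h => pw ((hinv w hw).mp h)⟩
    ((congrArg Finset.card
      ((G.cutEdges_contractOn _ _ p).trans (G.cutEdges_congr hinv))).trans hp) rfl
  exact ⟨H, .head ⟨C, hC, rfl⟩ hH, hbond⟩

theorem IsBondGraph.card_V {H : MGraph} {n : ℕ} (h : H.IsBondGraph n) : H.V.card = 2 := by
  obtain ⟨u, v, huv, hV, -⟩ := h
  rw [hV, Finset.card_pair huv]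

theorem IsBondGraph.le_of_cutsAtLeast {H : MGraph} {n k : ℕ} (h : H.IsBondGraph n)
    (hk : H.CutsAtLeast k) : k ≤ n := by
  obtain ⟨u, v, huv, hV, hE, -⟩ := h
  exact hE ▸ (hk (· = u) ⟨u, by simp [hV], rfl⟩ ⟨v, by simp [hV], huv.symm⟩).trans
    (Finset.card_le_card (Finset.filter_subset _ _))

end MGraph

/-- For `k > 3`, a loopless graph `G` is in `F_k` if and only if `G` is in `F_{k-1}` and
`G` has no cc-minor isomorphic to the bond graph `B_{k-1}`. -/
theorem statement_13 (k : ℕ) (hk : 3 < k) (G : MGraph) (hG : G.Loopless) :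
    Fclass k G ↔
      (Fclass (k - 1) G ∧ ¬ ∃ H, G.CCMinor H ∧ H.IsBondGraph (k - 1)) := by
  simp only [Fclass, show k ≠ 1 by omega, show k - 1 ≠ 1 by omega, if_false,
    MGraph.edgeConnected_iff]
  constructor
  · rintro (⟨-, hV, hcut⟩ | ⟨hV, hE⟩)
    · refine ⟨.inl ⟨hG, hV, fun p h₁ h₂ => (Nat.sub_le k 1).trans (hcut p h₁ h₂)⟩, ?_⟩
      rintro ⟨H, hH, hbond⟩
      have := hbond.le_of_cutsAtLeast (hcut.ccMinor hH)
      omega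
    · refine ⟨.inr ⟨hV, hE⟩, ?_⟩
      rintro ⟨H, hH, hbond⟩
      have := hH.card_le
      rw [hbond.card_V] at this
      omega
  · rintro ⟨⟨-, hV, hcut⟩ | h, hminor⟩
    · refine .inl ⟨hG, hV, fun p hin hout => ?_⟩
      by_contra! hlt
      have := hcut p hin hout
      exact hminor (MGraph.exists_ccMinor_isBondGraph (by omega) hG hcut hin hout (by omega))
    · exact .inr h
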